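/- arXiv:1401.2725 — 2 statements merged into one kernel-verified Lean document; each statement's English description precedes it below -/
import Mathlib

section
/- The principal congruence subgroup Γ(3) of SL(2,ℤ) is generated by the three matrices [[1,3],[0,1]], [[1,0],[-3,1]], and [[-2,3],[-3,4]]. -/
open Matrix MatrixGroups CongruenceSubgroup

def h1 : SL(2, ℤ) := ⟨!![1, 3; 0, 1], by norm_num [Matrix.det_fin_two_of]⟩
def h2 : SL(2, ℤ) := ⟨!![1, 0; -3, 1], by norm_num [Matrix.det_fin_two_of]⟩
def h3 : SL(2, ℤ) := ⟨!![-2, 3; -3, 4], by norm_num [Matrix.det_fin_two_of]⟩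

lemma mem_Gamma_three_iff (g : SL(2, ℤ)) :
    g ∈ Gamma 3 ↔ (3 : ℤ) ∣ g 0 0 - 1 ∧ (3 : ℤ) ∣ g 0 1 ∧ (3 : ℤ) ∣ g 1 0 ∧
      (3 : ℤ) ∣ g 1 1 - 1 := by
  have key (x : ℤ) : (3 : ℤ) ∣ x ↔ (x : ZMod 3) = 0 := by
    simpa using (ZMod.intCast_zmod_eq_zero_iff_dvd x 3).symm
  simp only [Gamma_mem, key, Int.cast_sub, Int.cast_one, sub_eq_zero]

lemma coe_h1 : (↑h1 : Matrix (Fin 2) (Fin 2) ℤ) = !![1, 3; 0, 1] := rfl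
lemma coe_h2 : (↑h2 : Matrix (Fin 2) (Fin 2) ℤ) = !![1, 0; -3, 1] := rfl
lemma coe_h3 : (↑h3 : Matrix (Fin 2) (Fin 2) ℤ) = !![-2, 3; -3, 4] := rfl

lemma h1_eq_T_pow : h1 = ModularGroup.T ^ (3 : ℤ) := by
  apply Subtype.ext
  exact (ModularGroup.coe_T_zpow 3).symm

lemma h1_zpow (k : ℤ) : (↑(h1 ^ k) : Matrix (Fin 2) (Fin 2) ℤ) = !![1, 3 * k; 0, 1] := by
  rw [h1_eq_T_pow, ← _root_.zpow_mul, ModularGroup.coe_T_zpow]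

lemma closure_le_Gamma_three : Subgroup.closure ({h1, h2, h3} : Set SL(2, ℤ)) ≤ Gamma 3 := by
  rw [Subgroup.closure_le]
  rintro x (rfl | rfl | rfl) <;> rw [SetLike.mem_coe, mem_Gamma_three_iff] <;>
    simp [h1, h2, h3]

/-- A translation by a multiple of `3 * c` brings `a` to its absolutely least residue. -/
lemma exists_abs_two_mul_add_le (a c : ℤ) (hc : c ≠ 0) :
    ∃ k : ℤ, |2 * (a + 3 * k * c)| ≤ 3 * |c| := by
  have hpos : 0 < |c| := abs_pos.mpr hc
  have hlo := Int.emod_nonneg (2 * a + 3 * |c|) (b := 6 * |c|) (by omega)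
  have hhi := Int.emod_lt_of_pos (2 * a + 3 * |c|) (b := 6 * |c|) (by omega)
  rw [Int.emod_def] at hlo hhi
  set q := (2 * a + 3 * |c|) / (6 * |c|)
  rcases abs_choice c with h | h <;> rw [h] at hlo hhi ⊢
  · exact ⟨-q, abs_le.mpr ⟨by linarith, by linarith⟩⟩
  · exact ⟨q, abs_le.mpr ⟨by linarith, by linarith⟩⟩

/-- The lower left entry of a reduced element of `Γ(3)` can be made smaller by one of the
generators, or by `h2 * h3 * h1`, or by their inverses. -/
lemma exists_mem_closure_natAbs_lt (g : SL(2, ℤ)) (hg : (3 : ℤ) ∣ g 1 0) (hc : g 1 0 ≠ 0)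
    (hred : |2 * g 0 0| ≤ 3 * |g 1 0|) :
    ∃ h ∈ Subgroup.closure ({h1, h2, h3} : Set SL(2, ℤ)),
      ((h * g) 1 0).natAbs < (g 1 0).natAbs := by
  have m1 : h1 ∈ Subgroup.closure ({h1, h2, h3} : Set SL(2, ℤ)) :=
    Subgroup.subset_closure (by simp)
  have m2 : h2 ∈ Subgroup.closure ({h1, h2, h3} : Set SL(2, ℤ)) :=
    Subgroup.subset_closure (by simp)
  have m3 : h3 ∈ Subgroup.closure ({h1, h2, h3} : Set SL(2, ℤ)) :=
    Subgroup.subset_closure (by simp)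
  have m4 := mul_mem (mul_mem m2 m3) m1
  have e1 : (h2 * g) 1 0 = g 1 0 - 3 * g 0 0 := by
    simp [coe_h2, Matrix.mul_apply, Fin.sum_univ_two]; ring
  have e2 : (h2⁻¹ * g) 1 0 = g 1 0 + 3 * g 0 0 := by
    simp [coe_h2, Matrix.mul_apply, Fin.sum_univ_two, Matrix.adjugate_fin_two]; ring
  have e3 : (h3 * g) 1 0 = 4 * g 1 0 - 3 * g 0 0 := by
    simp [coe_h3, Matrix.mul_apply, Fin.sum_univ_two]; ring
  have e4 : (h3⁻¹ * g) 1 0 = 3 * g 0 0 - 2 * g 1 0 := by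
    simp [coe_h3, Matrix.mul_apply, Fin.sum_univ_two, Matrix.adjugate_fin_two]; ring
  have e5 : (h2 * h3 * h1 * g) 1 0 = 4 * g 1 0 + 3 * g 0 0 := by
    simp [coe_h1, coe_h2, coe_h3, Matrix.mul_apply, Fin.sum_univ_two]; ring
  have e6 : ((h2 * h3 * h1)⁻¹ * g) 1 0 = -3 * g 0 0 - 2 * g 1 0 := by
    simp [coe_h1, coe_h2, coe_h3, Matrix.mul_apply, Fin.sum_univ_two, Matrix.adjugate_fin_two]; ring
  have hdet : g 0 0 * g 1 1 - g 0 1 * g 1 0 = 1 := by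
    rw [← Matrix.det_fin_two]; exact g.det_coe
  have not_dvd : ¬ g 1 0 ∣ 1 := fun h => absurd (hg.trans h) (by norm_num)
  have n0 : g 0 0 ≠ 0 := fun h => not_dvd ⟨-g 0 1, by rw [h] at hdet; linarith⟩
  have n1 : g 0 0 ≠ g 1 0 := fun h => not_dvd ⟨g 1 1 - g 0 1, by rw [h] at hdet; linarith⟩
  have n2 : g 0 0 ≠ -g 1 0 := fun h => not_dvd ⟨-g 1 1 - g 0 1, by rw [h] at hdet; linarith⟩
  by_contra! H
  have f1 := H _ m2
  have f2 := H _ (inv_mem m2)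
  have f3 := H _ m3
  have f4 := H _ (inv_mem m3)
  have f5 := H _ m4
  have f6 := H _ (inv_mem m4)
  rw [e1] at f1
  rw [e2] at f2
  rw [e3] at f3
  rw [e4] at f4
  rw [e5] at f5
  rw [e6] at f6
  clear H e1 e2 e3 e4 e5 e6 m1 m2 m3 m4 hdet not_dvd
  generalize g 0 0 = a at *
  generalize g 1 0 = c at *
  rw [Int.abs_eq_natAbs, Int.abs_eq_natAbs] at hred
  omega

lemma mem_closure_of_lower_left_eq_zero (g : SL(2, ℤ)) (hg : g ∈ Gamma 3) (hc : g 1 0 = 0) :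
    g ∈ Subgroup.closure ({h1, h2, h3} : Set SL(2, ℤ)) := by
  obtain ⟨ha, ⟨k, hk⟩, -, -⟩ := (mem_Gamma_three_iff g).mp hg
  have hdet : g 0 0 * g 1 1 = 1 := by
    have := g.det_coe
    rwa [Matrix.det_fin_two, hc, mul_zero, sub_zero] at this
  have hg_eq : g = h1 ^ k := by
    rcases Int.mul_eq_one_iff_eq_one_or_neg_one.mp hdet with ⟨h, h'⟩ | ⟨h, h'⟩
    · ext i j
      fin_cases i <;> fin_cases j <;> simp [h, h', hc, hk, h1_zpow]
    · omega
  rw [hg_eq]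
  exact zpow_mem (Subgroup.subset_closure (by simp)) k

lemma Gamma_three_le_closure : Gamma 3 ≤ Subgroup.closure ({h1, h2, h3} : Set SL(2, ℤ)) := by
  intro g hg
  induction hn : (g 1 0).natAbs using Nat.strong_induction_on generalizing g with
  | _ n ih =>
    by_cases hc : g 1 0 = 0
    · exact mem_closure_of_lower_left_eq_zero g hg hc
    obtain ⟨k, hk⟩ := exists_abs_two_mul_add_le (g 0 0) (g 1 0) hc
    have hmem : h1 ^ k ∈ Subgroup.closure ({h1, h2, h3} : Set SL(2, ℤ)) :=
      zpow_mem (Subgroup.subset_closure (by simp)) k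
    have e0 : (h1 ^ k * g) 0 0 = g 0 0 + 3 * k * g 1 0 := by
      simp [h1_zpow, Matrix.mul_apply, Fin.sum_univ_two]
    have e1 : (h1 ^ k * g) 1 0 = g 1 0 := by
      simp [h1_zpow, Matrix.mul_apply, Fin.sum_univ_two]
    obtain ⟨h, hh, hlt⟩ := exists_mem_closure_natAbs_lt (h1 ^ k * g)
      (by rw [e1]; exact ((mem_Gamma_three_iff g).mp hg).2.2.1) (by rwa [e1])
      (by rwa [e0, e1])
    rw [e1, hn] at hlt
    have := ih _ hlt
      (mul_mem (closure_le_Gamma_three hh) (mul_mem (closure_le_Gamma_three hmem) hg)) rfl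
    rwa [Subgroup.mul_mem_cancel_left _ hh, Subgroup.mul_mem_cancel_left _ hmem] at this

theorem stmt_15 :
    Subgroup.closure ({h1, h2, h3} : Set SL(2, ℤ)) = Gamma 3 :=
  le_antisymm closure_le_Gamma_three Gamma_three_le_closure
end

section
/- Let Z be the normal subgroup of GL(2,ℂ) consisting of the scalar matrices ζ·I with ζ⁶ = 1. There exists a unique group homomorphism ψ from SL(2,ℤ) to the quotient group GL(2,ℂ)/Z such that ψ([[1,1],[0,1]]) is the class of B₁ = diag(1,-1) and ψ([[1,0],[-1,1]]) is the class of B₃ = [[-1/2, i/(2√3)],[-3√3 i/2, 1/2]], and the kernel of ψ is exactly the principal congruence subgroup Γ(2). -/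
open Matrix MatrixGroups Complex CongruenceSubgroup

/-- The monodromy matrix `M_{1,1/2} = diag(1,-1)`. -/
noncomputable def B1 : Matrix (Fin 2) (Fin 2) ℂ := !![1, 0; 0, -1]

/-- The monodromy matrix `M_{3,1/2}`. -/
noncomputable def B3 : Matrix (Fin 2) (Fin 2) ℂ :=
  !![-1 / 2, Complex.I / (2 * Real.sqrt 3);
     -(3 * Real.sqrt 3 * Complex.I) / 2, 1 / 2]

/-- The invariant-part monodromy matrix `M_{1,0} = [[1,1],[0,1]]`. -/
def M1 : SL(2, ℤ) := ⟨!![1, 1; 0, 1], by norm_num [Matrix.det_fin_two_of]⟩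

/-- The invariant-part monodromy matrix `M_{3,0} = [[1,0],[-1,1]]`. -/
def M3 : SL(2, ℤ) := ⟨!![1, 0; -1, 1], by norm_num [Matrix.det_fin_two_of]⟩

/-- The subgroup of `GL(2,ℂ)` consisting of the scalar matrices `ζ·I` with `ζ⁶ = 1`. -/
def Z : Subgroup (GL (Fin 2) ℂ) where
  carrier := {x | ∃ ζ : ℂ, ζ ^ 6 = 1 ∧
    (x : Matrix (Fin 2) (Fin 2) ℂ) = ζ • (1 : Matrix (Fin 2) (Fin 2) ℂ)}
  one_mem' := ⟨1, one_pow 6, by simp⟩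
  mul_mem' := by
    rintro a b ⟨ζ, hζ, ha⟩ ⟨ξ, hξ, hb⟩
    refine ⟨ζ * ξ, by rw [mul_pow, hζ, hξ, mul_one], ?_⟩
    show ((a * b : GL (Fin 2) ℂ) : Matrix (Fin 2) (Fin 2) ℂ) = _
    rw [Units.val_mul, ha, hb, smul_mul_assoc, mul_smul_comm, smul_smul, one_mul]
  inv_mem' := by
    rintro a ⟨ζ, hζ, ha⟩
    have hζ0 : ζ ≠ 0 := by
      intro h
      rw [h] at hζ
      simp at hζ
    refine ⟨ζ⁻¹, by rw [inv_pow, hζ, inv_one], ?_⟩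
    have h2 : ζ⁻¹ • ((a : GL (Fin 2) ℂ) : Matrix (Fin 2) (Fin 2) ℂ) = 1 := by
      rw [ha, smul_smul, inv_mul_cancel₀ hζ0, one_smul]
    calc ((a⁻¹ : GL (Fin 2) ℂ) : Matrix (Fin 2) (Fin 2) ℂ)
        = 1 * ((a⁻¹ : GL (Fin 2) ℂ) : Matrix (Fin 2) (Fin 2) ℂ) := (one_mul _).symm
      _ = (ζ⁻¹ • ((a : GL (Fin 2) ℂ) : Matrix (Fin 2) (Fin 2) ℂ)) *
            ((a⁻¹ : GL (Fin 2) ℂ) : Matrix (Fin 2) (Fin 2) ℂ) := by rw [h2]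
      _ = ζ⁻¹ • (((a : GL (Fin 2) ℂ) : Matrix (Fin 2) (Fin 2) ℂ) *
            ((a⁻¹ : GL (Fin 2) ℂ) : Matrix (Fin 2) (Fin 2) ℂ)) := by rw [smul_mul_assoc]
      _ = ζ⁻¹ • (1 : Matrix (Fin 2) (Fin 2) ℂ) := by
            rw [← Units.val_mul, mul_inv_cancel, Units.val_one]

instance Z_normal : Z.Normal := by
  constructor
  rintro x ⟨ζ, hζ, hx⟩ g
  refine ⟨ζ, hζ, ?_⟩
  show ((g * x * g⁻¹ : GL (Fin 2) ℂ) : Matrix (Fin 2) (Fin 2) ℂ) = _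
  rw [Units.val_mul, Units.val_mul, hx, mul_smul_comm, smul_mul_assoc, mul_one,
    ← Units.val_mul, mul_inv_cancel, Units.val_one]

/-- The lift of an element of `SL(2, 𝔽₂) ≅ S₃` to an integral matrix reducing to it modulo `2`,
given by the two-dimensional standard representation of `S₃`. -/
def standardMatrix (g : SL(2, ZMod 2)) : Matrix (Fin 2) (Fin 2) ℤ :=
  !![(g 0 0).val * (1 - 2 * (g 0 1).val), (g 0 1).val * (2 * (g 0 0).val - 1);
     (g 1 0).val * (2 * (g 1 1).val - 1), (g 1 1).val * (1 - 2 * (g 1 0).val)]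

lemma standardMatrix_one : standardMatrix 1 = 1 := by decide

lemma standardMatrix_mul (g h : SL(2, ZMod 2)) :
    standardMatrix (g * h) = standardMatrix g * standardMatrix h := by
  revert g h
  decide +kernel

lemma eq_one_of_standardMatrix_offDiag_eq_zero (g : SL(2, ZMod 2))
    (h₀₁ : standardMatrix g 0 1 = 0) (h₁₀ : standardMatrix g 1 0 = 0) : g = 1 := by
  revert g
  decide +kernel

/-- The integral standard representation of `SL(2, 𝔽₂)`. -/
def standardRep : SL(2, ZMod 2) →* GL (Fin 2) ℤ :=
  MonoidHom.toHomUnits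
    { toFun := standardMatrix
      map_one' := standardMatrix_one
      map_mul' := standardMatrix_mul }

lemma coe_standardRep (g : SL(2, ZMod 2)) :
    (standardRep g : Matrix (Fin 2) (Fin 2) ℤ) = standardMatrix g := rfl

lemma ofReal_sqrt_three_ne_zero : (Real.sqrt 3 : ℂ) ≠ 0 := by
  simp

lemma ofReal_sqrt_three_sq : (Real.sqrt 3 : ℂ) ^ 2 = 3 := by
  rw [← Complex.ofReal_pow, Real.sq_sqrt (by norm_num)]
  norm_num

/-- The base change whose columns are `(-1)`-eigenvectors of `B1` and `B3`. -/
noncomputable def eigenbasis : GL (Fin 2) ℂ :=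
  Matrix.GeneralLinearGroup.mkOfDetNeZero
    !![0, Complex.I / (2 * Real.sqrt 3); 1, -1 / 2] (by simp [Matrix.det_fin_two_of])

lemma coe_eigenbasis : (eigenbasis : Matrix (Fin 2) (Fin 2) ℂ) =
    !![0, Complex.I / (2 * Real.sqrt 3); 1, -1 / 2] := rfl

/-- The twisted-sector monodromy representation of `SL(2, ℤ)`. -/
noncomputable def twistedRep : SL(2, ℤ) →* GL (Fin 2) ℂ :=
  (MulAut.conj eigenbasis).toMonoidHom.comp
    ((Matrix.GeneralLinearGroup.map (Int.castRingHom ℂ)).comp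
      (standardRep.comp (Matrix.SpecialLinearGroup.map (Int.castRingHom (ZMod 2)))))

lemma twistedRep_apply (γ : SL(2, ℤ)) : twistedRep γ = eigenbasis *
    Matrix.GeneralLinearGroup.map (Int.castRingHom ℂ)
      (standardRep (Matrix.SpecialLinearGroup.map (Int.castRingHom (ZMod 2)) γ)) *
    eigenbasis⁻¹ := rfl

lemma coe_twistedRep_mul_eigenbasis (γ : SL(2, ℤ)) :
    (twistedRep γ : Matrix (Fin 2) (Fin 2) ℂ) * eigenbasis = eigenbasis *
      (standardMatrix (Matrix.SpecialLinearGroup.map (Int.castRingHom (ZMod 2)) γ)).map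
        (Int.castRingHom ℂ) := by
  have h := congrArg (Units.val) (mul_eq_of_eq_mul_inv (twistedRep_apply γ))
  rwa [Units.val_mul, Units.val_mul] at h

lemma coe_twistedRep_eq {γ : SL(2, ℤ)} {B : Matrix (Fin 2) (Fin 2) ℂ}
    (h : B * eigenbasis = eigenbasis *
      (standardMatrix (Matrix.SpecialLinearGroup.map (Int.castRingHom (ZMod 2)) γ)).map
        (Int.castRingHom ℂ)) :
    (twistedRep γ : Matrix (Fin 2) (Fin 2) ℂ) = B :=
  eigenbasis.isUnit.mul_right_cancel ((coe_twistedRep_mul_eigenbasis γ).trans h.symm)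

lemma coe_twistedRep_M1 : (twistedRep M1 : Matrix (Fin 2) (Fin 2) ℂ) = B1 := by
  apply coe_twistedRep_eq
  have h : standardMatrix (Matrix.SpecialLinearGroup.map (Int.castRingHom (ZMod 2)) M1) =
    !![-1, 1; 0, 1] := by decide
  rw [h, coe_eigenbasis, B1]
  ext i j
  fin_cases i <;> fin_cases j <;> norm_num [Matrix.mul_apply, Fin.sum_univ_two]

lemma coe_twistedRep_M3 : (twistedRep M3 : Matrix (Fin 2) (Fin 2) ℂ) = B3 := by
  apply coe_twistedRep_eq
  have h : standardMatrix (Matrix.SpecialLinearGroup.map (Int.castRingHom (ZMod 2)) M3) =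
    !![1, 0; 1, -1] := by decide
  have h₀ := ofReal_sqrt_three_ne_zero
  rw [h, coe_eigenbasis, B3]
  ext i j
  fin_cases i <;> fin_cases j <;> simp [Matrix.mul_apply, Fin.sum_univ_two] <;>
    field_simp <;> norm_num [Complex.I_sq]

lemma twistedRep_mem_Z_iff (γ : SL(2, ℤ)) : twistedRep γ ∈ Z ↔ γ ∈ CongruenceSubgroup.Gamma 2 := by
  rw [Gamma_mem']
  constructor
  · rintro ⟨ζ, -, h⟩
    have hc := coe_twistedRep_mul_eigenbasis γ
    rw [h, smul_one_mul, ← mul_smul_one] at hc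
    have hs := eigenbasis.isUnit.mul_left_cancel hc
    apply eq_one_of_standardMatrix_offDiag_eq_zero
    · simpa using (congrFun (congrFun hs 0) 1).symm
    · simpa using (congrFun (congrFun hs 1) 0).symm
  · intro h
    rw [twistedRep_apply, h]
    simp [Z.one_mem]

lemma closure_M1_M3 : Subgroup.closure {M1, M3} = ⊤ := by
  have h₁ : M1 ∈ Subgroup.closure {M1, M3} := Subgroup.subset_closure (by simp)
  have h₃ : M3 ∈ Subgroup.closure {M1, M3} := Subgroup.subset_closure (by simp)
  rw [eq_top_iff, ← SpecialLinearGroup.SL2Z_generators, Subgroup.closure_le]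
  rintro _ (rfl | rfl)
  · have h : ModularGroup.S = (M1 * M3 * M1)⁻¹ := by decide
    rw [h]
    exact inv_mem (mul_mem (mul_mem h₁ h₃) h₁)
  · exact h₁

lemma monoidHom_ext_M1_M3 {G : Type*} [Group G] {φ ψ : SL(2, ℤ) →* G}
    (h₁ : φ M1 = ψ M1) (h₃ : φ M3 = ψ M3) : φ = ψ := by
  apply MonoidHom.eq_of_eqOn_dense closure_M1_M3
  rintro _ (rfl | rfl)
  exacts [h₁, h₃]

theorem stmt_18 :
    ∃ b1 b3 : GL (Fin 2) ℂ,
      (b1 : Matrix (Fin 2) (Fin 2) ℂ) = B1 ∧ (b3 : Matrix (Fin 2) (Fin 2) ℂ) = B3 ∧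
      (∃! ψ : SL(2, ℤ) →* (GL (Fin 2) ℂ ⧸ Z),
        ψ M1 = QuotientGroup.mk b1 ∧ ψ M3 = QuotientGroup.mk b3) ∧
      (∀ ψ : SL(2, ℤ) →* (GL (Fin 2) ℂ ⧸ Z),
        ψ M1 = QuotientGroup.mk b1 → ψ M3 = QuotientGroup.mk b3 →
          ψ.ker = CongruenceSubgroup.Gamma 2) := by
  refine ⟨twistedRep M1, twistedRep M3, coe_twistedRep_M1, coe_twistedRep_M3,
    ⟨(QuotientGroup.mk' Z).comp twistedRep, ⟨rfl, rfl⟩,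
      fun ψ h => monoidHom_ext_M1_M3 h.1 h.2⟩, fun ψ h₁ h₃ => ?_⟩
  obtain rfl : ψ = (QuotientGroup.mk' Z).comp twistedRep := monoidHom_ext_M1_M3 h₁ h₃
  ext γ
  rw [← twistedRep_mem_Z_iff, MonoidHom.mem_ker]
  exact QuotientGroup.eq_one_iff _
end
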